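/- Let A be a symmetric convex body in ℝⁿ whose norm satisfies the Gaussian concentration inequality γₙ(|‖x‖_A − m| > t) ≤ e^{−c t²/b²} for all t > 0, where m is the γₙ-median, b = sup_{θ ∈ S^{n−1}} ‖θ‖_A, and c > 0. Then for every q ≥ 1, M_q(A) := (∫_{S^{n−1}} ‖θ‖_A^q dσ(θ))^{1/q} ≤ M(A) √(1 + c₁ q b²/(n M(A)²)) for an absolute constant c₁ > 0 (equivalently M_q(A) ≤ M(A)√(1 + c₁ q/k(A)) with k(A) ≍ n M(A)²/b²). -/

import Mathlib

open MeasureTheory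
open scoped ENNReal

/-- The standard Gaussian measure `γₙ` on `ℝⁿ`. -/
noncomputable def stdGaussian (n : ℕ) : Measure (EuclideanSpace ℝ (Fin n)) :=
  volume.withDensity fun x =>
    ENNReal.ofReal ((2 * Real.pi) ^ (-(n : ℝ) / 2) * Real.exp (-‖x‖ ^ 2 / 2))

/-- The uniform (rotation invariant) probability measure `σ` on the unit sphere
`S^{n-1} ⊆ ℝⁿ`. -/
noncomputable def sphereUniform (n : ℕ) :
    Measure (Metric.sphere (0 : EuclideanSpace ℝ (Fin n)) 1) :=
  ((volume : Measure (EuclideanSpace ℝ (Fin n))).toSphere Set.univ)⁻¹ •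
    (volume : Measure (EuclideanSpace ℝ (Fin n))).toSphere


lemma aux_exp_le (x : ℝ) : Real.exp x ≤ x + Real.exp (x ^ 2) := by
  have h1 := Real.add_one_le_exp (x ^ 2)
  by_cases hx : |x| ≤ 1
  · have := (abs_le.1 (Real.abs_exp_sub_one_sub_id_le hx)).2
    linarith
  · rcases lt_abs.1 (not_le.1 hx) with h | h
    · have : Real.exp x ≤ Real.exp (x ^ 2) := Real.exp_le_exp.2 (by nlinarith)
      linarith
    · have : Real.exp x ≤ 1 := Real.exp_le_one_iff.2 (by linarith)
      nlinarith

lemma aux_exp_conv (θ W : ℝ) (h0 : 0 ≤ θ) (h1 : θ ≤ 1) :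
    Real.exp (θ * W) ≤ 1 + θ * (Real.exp W - 1) := by
  have := convexOn_exp.2 (Set.mem_univ W) (Set.mem_univ 0) h0 (sub_nonneg.2 h1) (by ring)
  simp only [smul_eq_mul, mul_zero, add_zero, Real.exp_zero, mul_one] at this
  linarith

lemma aux_int : IntegrableOn (fun u : ℝ => ((1 + u) ^ 2)⁻¹) (Set.Ioi 0) ∧
    ∫ u in Set.Ioi (0:ℝ), ((1 + u) ^ 2)⁻¹ = 1 := by
  have hd : ∀ x ∈ Set.Ici (0:ℝ), HasDerivAt (fun u : ℝ => -(1 + u)⁻¹) (((1 + x) ^ 2)⁻¹) x := by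
    intro x hx
    have hx' : (1 + x) ≠ 0 := by have : (0:ℝ) ≤ x := hx; positivity
    have := (((hasDerivAt_id x).const_add 1).inv hx').neg
    exact this.congr_deriv (by simp [neg_div])
  have ht : Filter.Tendsto (fun u : ℝ => -(1 + u)⁻¹) Filter.atTop (nhds 0) := by
    have := (tendsto_inv_atTop_zero.comp (Filter.tendsto_atTop_add_const_left Filter.atTop (1:ℝ) Filter.tendsto_id)).neg
    simpa using this
  have hp : ∀ x ∈ Set.Ioi (0:ℝ), (0:ℝ) ≤ ((1 + x) ^ 2)⁻¹ := fun x _ => by positivity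
  refine ⟨integrableOn_Ioi_deriv_of_nonneg' hd hp ht, ?_⟩
  rw [integral_Ioi_of_hasDerivAt_of_nonneg' hd hp ht]; norm_num

section
variable {Ω : Type*} [MeasurableSpace Ω] (μ : Measure Ω) [IsProbabilityMeasure μ]

lemma aux_expsq (Z : Ω → ℝ) (hZ : Measurable Z) (s : ℝ) (hs : 0 < s)
    (h : ∀ t : ℝ, 0 < t → μ {x | t < |Z x|} ≤ ENNReal.ofReal (Real.exp (-(2 * s) * t ^ 2))) :
    Integrable (fun x => Real.exp (s * Z x ^ 2)) μ ∧ ∫ x, Real.exp (s * Z x ^ 2) ∂μ ≤ 2 := by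
  set G : Ω → ℝ := fun x => Real.exp (s * Z x ^ 2) - 1 with hG
  have hGm : Measurable G := by fun_prop
  have hG0 : ∀ x, 0 ≤ G x := fun x => by
    have : 0 ≤ s * Z x ^ 2 := by positivity
    have := Real.one_le_exp this
    simp only [hG]; linarith
  have hl : ∫⁻ x, ENNReal.ofReal (G x) ∂μ ≤ 1 := by
    rw [lintegral_eq_lintegral_meas_lt μ (Filter.Eventually.of_forall hG0) hGm.aemeasurable]
    calc ∫⁻ t in Set.Ioi (0:ℝ), μ {a | t < G a} 
        ≤ ∫⁻ t in Set.Ioi (0:ℝ), ENNReal.ofReal (((1 + t) ^ 2)⁻¹) := by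
          refine setLIntegral_mono (by fun_prop) ?_
          intro u hu
          have hu : 0 < u := hu
          have hlog : 0 < Real.log (1 + u) := Real.log_pos (by linarith)
          have hpos : 0 < Real.log (1 + u) / s := by positivity
          refine (measure_mono ?_).trans ((h (Real.sqrt (Real.log (1 + u) / s)) (Real.sqrt_pos.2 hpos)).trans ?_)
          · intro x hx
            have hx : u < Real.exp (s * Z x ^ 2) - 1 := hx
            have : Real.log (1 + u) < s * Z x ^ 2 :=
              (Real.log_lt_iff_lt_exp (by linarith)).2 (by linarith)
            show _ < |Z x|
            rw [← Real.sqrt_sq_eq_abs]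
            apply Real.sqrt_lt_sqrt hpos.le
            rw [div_lt_iff₀ hs]; linarith
          · apply ENNReal.ofReal_le_ofReal
            rw [Real.sq_sqrt hpos.le]
            have : -(2 * s) * (Real.log (1 + u) / s) = -(Real.log ((1 + u) ^ 2)) := by
              rw [Real.log_pow]; field_simp; norm_num
            rw [this, Real.exp_neg, Real.exp_log (by positivity)]
      _ = 1 := by
          rw [← ofReal_integral_eq_lintegral_ofReal aux_int.1 (Filter.Eventually.of_forall fun x => by positivity), aux_int.2]
          simp
  have hGi : Integrable G μ := by
    refine ⟨hGm.aestronglyMeasurable, ?_⟩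
    rw [hasFiniteIntegral_iff_ofReal (Filter.Eventually.of_forall hG0)]
    exact hl.trans_lt ENNReal.one_lt_top
  have hGint : ∫ x, G x ∂μ ≤ 1 := by
    rw [integral_eq_lintegral_of_nonneg_ae (Filter.Eventually.of_forall hG0) hGm.aestronglyMeasurable]
    exact ENNReal.toReal_le_of_le_ofReal zero_le_one (by simpa using hl)
  have he : (fun x => Real.exp (s * Z x ^ 2)) = fun x => G x + 1 := by ext x; simp [hG]
  rw [he]
  refine ⟨hGi.add (integrable_const _), ?_⟩
  rw [integral_add hGi (integrable_const _)]
  simp; linarith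

/-- Centered version. -/
lemma aux_center (f : Ω → ℝ) (hf : Measurable f) (m s : ℝ) (hs : 0 < s)
    (h : ∀ t : ℝ, 0 < t → μ {x | t < |f x - m|} ≤ ENNReal.ofReal (Real.exp (-(4 * s) * t ^ 2))) :
    Integrable f μ ∧ Integrable (fun x => Real.exp (s * (f x - ∫ y, f y ∂μ) ^ 2)) μ ∧
      ∫ x, Real.exp (s * (f x - ∫ y, f y ∂μ) ^ 2) ∂μ ≤ 6 := by
  obtain ⟨hi, h2⟩ := aux_expsq μ (fun x => f x - m) (by fun_prop) (2 * s) (by positivity)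
    (by intro t ht; convert h t ht using 4; ring)
  have hsqi : Integrable (fun x => (f x - m) ^ 2) μ := by
    refine (hi.const_mul (2 * s)⁻¹).mono' (by fun_prop) (Filter.Eventually.of_forall fun x => ?_)
    rw [Real.norm_of_nonneg (by positivity), inv_mul_eq_div, le_div_iff₀ (by positivity)]
    have := Real.add_one_le_exp (2 * s * (f x - m) ^ 2)
    linarith
  have hL2 : MemLp (fun x => f x - m) 2 μ := (memLp_two_iff_integrable_sq (by fun_prop)).2 hsqi
  have hZi : Integrable (fun x => f x - m) μ := hL2.integrable (by norm_num)
  have hfi : Integrable f μ := by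
    have := hZi.add (integrable_const m)
    refine this.congr (Filter.Eventually.of_forall fun x => ?_)
    simp
  have hsq : 2 * s * ∫ x, (f x - m) ^ 2 ∂μ ≤ 1 := by
    rw [← integral_const_mul]
    have : ∫ x, (2 * s * (f x - m) ^ 2 + 1) ∂μ ≤ 2 := by
      refine le_trans (integral_mono ((hsqi.const_mul _).add (integrable_const _)) hi ?_) h2
      intro x; exact Real.add_one_le_exp _
    rw [integral_add (hsqi.const_mul _) (integrable_const _)] at this
    simp at this; linarith
  set a := ∫ y, f y ∂μ with ha
  have hvar : (a - m) ^ 2 ≤ ∫ x, (f x - m) ^ 2 ∂μ := by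
    have hE : ∫ x, (f x - m) ∂μ = a - m := by
      rw [integral_sub hfi (integrable_const _)]; simp [ha]
    have h0 : 0 ≤ ∫ x, ((f x - m) ^ 2 - 2 * (a - m) * (f x - m) + (a - m) ^ 2) ∂μ :=
      integral_nonneg fun x => by
        show 0 ≤ _
        nlinarith [sq_nonneg ((f x - m) - (a - m))]
    have hi1 : Integrable (fun x => (f x - m) ^ 2 - 2 * (a - m) * (f x - m)) μ :=
      hsqi.sub (hZi.const_mul _)
    rw [integral_add hi1 (integrable_const _), integral_sub hsqi (hZi.const_mul _), integral_const_mul, hE] at h0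
    simp at h0; nlinarith
  have hb : 2 * s * (a - m) ^ 2 ≤ 1 :=
    (mul_le_mul_of_nonneg_left hvar (by positivity)).trans hsq
  have hpt : ∀ x, Real.exp (s * (f x - a) ^ 2) ≤ Real.exp 1 * Real.exp (2 * s * (f x - m) ^ 2) := by
    intro x
    rw [← Real.exp_add]
    apply Real.exp_le_exp.2
    nlinarith [mul_nonneg hs.le (sq_nonneg ((f x - m) + (a - m)))]
  have hI : Integrable (fun x => Real.exp (s * (f x - a) ^ 2)) μ := by
    refine (hi.const_mul (Real.exp 1)).mono' (by fun_prop) (Filter.Eventually.of_forall fun x => ?_)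
    rw [Real.norm_of_nonneg (Real.exp_pos _).le]; exact hpt x
  refine ⟨hfi, hI, ?_⟩
  have := integral_mono hI (hi.const_mul (Real.exp 1)) hpt
  rw [integral_const_mul] at this
  have he := Real.exp_one_lt_three
  nlinarith [Real.exp_pos 1]

lemma aux_mgf (f : Ω → ℝ) (hf : Measurable f) (s a : ℝ) (hs : 0 < s) (hfi : Integrable f μ)
    (ha : a = ∫ y, f y ∂μ) (hi : Integrable (fun x => Real.exp (s * (f x - a) ^ 2)) μ)
    (h6 : ∫ x, Real.exp (s * (f x - a) ^ 2) ∂μ ≤ 6) (l : ℝ) :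
    Integrable (fun x => Real.exp (l * (f x - a))) μ ∧
      ∫ x, Real.exp (l * (f x - a)) ∂μ ≤ Real.exp (5 * (l ^ 2 / s)) := by
  have hpt : ∀ x, Real.exp (l * (f x - a)) ≤ Real.exp (l ^ 2 / s / 2) * Real.exp (s * (f x - a) ^ 2) := by
    intro x
    rw [← Real.exp_add]
    apply Real.exp_le_exp.2
    have h1 : 0 ≤ (l - s * (f x - a)) ^ 2 / s := by positivity
    have h2 : (l - s * (f x - a)) ^ 2 / s = l ^ 2 / s - 2 * l * (f x - a) + s * (f x - a) ^ 2 := by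
      field_simp; ring
    have h3 : 0 ≤ s * (f x - a) ^ 2 := by positivity
    linarith
  have hI : Integrable (fun x => Real.exp (l * (f x - a))) μ := by
    refine (hi.const_mul (Real.exp (l ^ 2 / s / 2))).mono' (by fun_prop) (Filter.Eventually.of_forall fun x => ?_)
    rw [Real.norm_of_nonneg (Real.exp_pos _).le]; exact hpt x
  refine ⟨hI, ?_⟩
  set θ := l ^ 2 / s with hθ
  have hθ0 : 0 ≤ θ := by positivity
  by_cases h1 : θ ≤ 1
  · have hYi : Integrable (fun x => l * (f x - a)) μ := (hfi.sub (integrable_const _)).const_mul _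
    have hY0 : ∫ x, l * (f x - a) ∂μ = 0 := by
      rw [integral_const_mul, integral_sub hfi (integrable_const _)]; simp [ha]
    have hWi : Integrable (fun x => 1 + θ * (Real.exp (s * (f x - a) ^ 2) - 1)) μ :=
      (integrable_const _).add ((hi.sub (integrable_const _)).const_mul _)
    have hW : ∫ x, (1 + θ * (Real.exp (s * (f x - a) ^ 2) - 1)) ∂μ ≤ 1 + 5 * θ := by
      have hi1 : Integrable (fun x => Real.exp (s * (f x - a) ^ 2) - 1) μ :=
        hi.sub (integrable_const _)
      rw [integral_add (integrable_const _) (hi1.const_mul _),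
        integral_const_mul, integral_sub hi (integrable_const _)]
      simp; nlinarith
    have := integral_mono hI (hYi.add hWi) (fun x => by
      refine (aux_exp_le _).trans ?_
      have := aux_exp_conv θ (s * (f x - a) ^ 2) hθ0 h1
      have e : θ * (s * (f x - a) ^ 2) = (l * (f x - a)) ^ 2 := by
        rw [hθ]; field_simp
      rw [e] at this
      simpa using this)
    rw [integral_add' hYi hWi, hY0] at this
    have h5 := Real.add_one_le_exp (5 * θ)
    linarith
  · have := integral_mono hI (hi.const_mul _) hpt
    rw [integral_const_mul] at this
    refine this.trans ?_
    have h2 : (6:ℝ) ≤ Real.exp (2 * 1) := by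
      have := Real.exp_one_gt_d9
      rw [two_mul, Real.exp_add]; nlinarith
    calc Real.exp (θ / 2) * ∫ x, Real.exp (s * (f x - a) ^ 2) ∂μ
        ≤ Real.exp (θ / 2) * Real.exp (2 * 1) := by gcongr; linarith
      _ ≤ _ := by
        rw [← Real.exp_add]; apply Real.exp_le_exp.2; linarith

lemma aux_moment (f : Ω → ℝ) (hf : Measurable f) (hf0 : ∀ x, 0 ≤ f x) (m s : ℝ) (hs : 0 < s)
    (h : ∀ t : ℝ, 0 < t → μ {x | t < |f x - m|} ≤ ENNReal.ofReal (Real.exp (-(4 * s) * t ^ 2)))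
    (p : ℝ) (hp : 1 ≤ p) :
    (∫ x, f x ^ p ∂μ) ≤ (Real.sqrt ((∫ x, f x ∂μ) ^ 2 + 30 * p / s)) ^ p := by
  obtain ⟨hfi, hi, h6⟩ := aux_center μ f hf m s hs h
  set a := ∫ x, f x ∂μ with ha
  have hmgf := aux_mgf μ f hf s a hs hfi ha hi h6
  have ha0 : 0 ≤ a := integral_nonneg hf0
  set u := 5 * p / s with hu
  have hu0 : 0 < u := by positivity
  set r := Real.sqrt (a ^ 2 + 2 * u) with hr
  have hr0 : 0 < r := Real.sqrt_pos.2 (by positivity)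
  have hr2 : r ^ 2 = a ^ 2 + 2 * u := Real.sq_sqrt (by positivity)
  have har : a ≤ r := by nlinarith
  have hpt : ∀ x, f x ^ p ≤ r ^ p * Real.exp (p / r * (f x - a)) := by
    intro x
    have h1 : f x / r ≤ Real.exp (1 / r * (f x - a)) := by
      have := Real.add_one_le_exp (f x / r - 1)
      refine (by linarith : f x / r ≤ Real.exp (f x / r - 1)).trans (Real.exp_le_exp.2 ?_)
      have : a / r ≤ 1 := (div_le_one hr0).2 har
      have e : 1 / r * (f x - a) = f x / r - a / r := by ring
      linarith
    have h2 : f x ≤ r * Real.exp (1 / r * (f x - a)) := by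
      rw [div_le_iff₀ hr0] at h1; linarith
    refine (Real.rpow_le_rpow (hf0 x) h2 (by linarith)).trans (le_of_eq ?_)
    rw [Real.mul_rpow hr0.le (Real.exp_pos _).le, ← Real.exp_mul]
    congr 2; ring
  obtain ⟨hI, hb⟩ := hmgf (p / r)
  have hfp : Integrable (fun x => f x ^ p) μ := by
    refine (hI.const_mul (r ^ p)).mono' (hf.pow_const p).aestronglyMeasurable (Filter.Eventually.of_forall fun x => ?_)
    rw [Real.norm_of_nonneg (Real.rpow_nonneg (hf0 x) _)]; exact hpt x
  have h1 := integral_mono hfp (hI.const_mul _) hpt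
  rw [integral_const_mul] at h1
  have hrp : 0 ≤ r ^ p := by positivity
  refine h1.trans ((mul_le_mul_of_nonneg_left hb hrp).trans ?_)
  have e1 : 5 * ((p / r) ^ 2 / s) = (u / r ^ 2) * p := by rw [hu]; field_simp
  rw [e1, Real.exp_mul, ← Real.mul_rpow hr0.le (Real.exp_pos _).le]
  apply Real.rpow_le_rpow (by positivity) _ (by linarith)
  apply Real.le_sqrt_of_sq_le
  set v := u / r ^ 2 with hv
  have hvr : v * r ^ 2 = u := by rw [hv]; field_simp
  have hv0 : 0 ≤ v := by positivity
  have hv1 : 2 * v ≤ 1 := by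
    rw [hv, ← mul_div_assoc, div_le_one (by positivity)]; nlinarith
  have hev : Real.exp (2 * v) ≤ 1 + 4 * v := by
    have := aux_exp_conv (2 * v) 1 (by positivity) hv1
    have h3 := Real.exp_one_lt_three
    rw [mul_one] at this
    nlinarith
  have e2 : (r * Real.exp v) ^ 2 = r ^ 2 * Real.exp (2 * v) := by
    rw [mul_pow, two_mul, Real.exp_add]; ring
  rw [e2]
  have e3 : 30 * p / s = 6 * u := by rw [hu]; ring
  rw [e3]
  nlinarith [mul_le_mul_of_nonneg_left hev (sq_nonneg r)]
end

lemma sg_integral (n : ℕ) (h : EuclideanSpace ℝ (Fin n) → ℝ) :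
    ∫ x, h x ∂(stdGaussian n) = ∫ x, ((2 * Real.pi) ^ (-(n : ℝ) / 2) * Real.exp (-‖x‖ ^ 2 / 2)) * h x := by
  unfold stdGaussian
  rw [integral_withDensity_eq_integral_toReal_smul (by fun_prop) (by simp)]
  refine integral_congr_ae (Filter.Eventually.of_forall fun x => ?_)
  simp only [smul_eq_mul]
  rw [ENNReal.toReal_ofReal (by positivity)]

lemma sg_integrable (n : ℕ) (h : EuclideanSpace ℝ (Fin n) → ℝ)
    (hi : Integrable (fun x => ((2 * Real.pi) ^ (-(n : ℝ) / 2) * Real.exp (-‖x‖ ^ 2 / 2)) * h x)) :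
    Integrable h (stdGaussian n) := by
  unfold stdGaussian
  rw [integrable_withDensity_iff_integrable_smul' (by fun_prop) (by simp)]
  refine hi.congr (Filter.Eventually.of_forall fun x => ?_)
  simp only [smul_eq_mul]
  rw [ENNReal.toReal_ofReal (by positivity)]

lemma sg_prob (n : ℕ) : IsProbabilityMeasure (stdGaussian n) := by
  have hint : ∫ x : EuclideanSpace ℝ (Fin n), ((2 * Real.pi) ^ (-(n : ℝ) / 2) * Real.exp (-‖x‖ ^ 2 / 2)) = 1 := by
    have := GaussianFourier.integral_rexp_neg_mul_sq_norm (V := EuclideanSpace ℝ (Fin n)) (b := 1/2) (by norm_num)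
    rw [integral_const_mul]
    have e : ∀ x : EuclideanSpace ℝ (Fin n), -‖x‖ ^ 2 / 2 = -(1/2) * ‖x‖ ^ 2 := fun x => by ring
    simp_rw [e]
    rw [this, finrank_euclideanSpace_fin, show Real.pi / (1/2) = 2 * Real.pi by ring,
      ← Real.rpow_add (by positivity)]
    rw [show -(n:ℝ)/2 + n/2 = 0 by ring, Real.rpow_zero]
  constructor
  unfold stdGaussian
  rw [withDensity_apply _ MeasurableSet.univ, Measure.restrict_univ,
    ← ofReal_integral_eq_lintegral_ofReal, hint, ENNReal.ofReal_one]
  · by_contra hc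
    rw [integral_undef hc] at hint
    norm_num at hint
  · exact Filter.Eventually.of_forall fun x => by positivity

lemma sg_polar_aux (n : ℕ) (hn : 0 < n) (p : ℝ) (h : EuclideanSpace ℝ (Fin n) → ℝ)
    (hh : ∀ (r : ℝ), 0 < r → ∀ x, h (r • x) = r ^ p * h x) :
    ∫ x, h x ∂(stdGaussian n) =
      (∫ θ, h θ ∂((volume : Measure (EuclideanSpace ℝ (Fin n))).toSphere)) *
      ∫ r : Set.Ioi (0:ℝ), (r:ℝ) ^ p * ((2 * Real.pi) ^ (-(n : ℝ) / 2) * Real.exp (-(r:ℝ) ^ 2 / 2))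
        ∂(Measure.volumeIoiPow (Module.finrank ℝ (EuclideanSpace ℝ (Fin n)) - 1)) := by
  have : NeZero n := ⟨hn.ne'⟩
  rw [sg_integral, ← integral_prod_mul
    (μ := (volume : Measure (EuclideanSpace ℝ (Fin n))).toSphere)
    (f := fun θ => h θ)
    (g := fun r : Set.Ioi (0:ℝ) => (r:ℝ) ^ p * ((2 * Real.pi) ^ (-(n : ℝ) / 2) * Real.exp (-(r:ℝ) ^ 2 / 2)))]
  rw [← (volume : Measure (EuclideanSpace ℝ (Fin n))).measurePreserving_homeomorphUnitSphereProd.integral_comp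
        (Homeomorph.measurableEmbedding _)]
  rw [← restrict_compl_singleton (μ := (volume : Measure (EuclideanSpace ℝ (Fin n)))) 0,
    ← integral_subtype_comap (measurableSet_singleton _).compl]
  rw [restrict_compl_singleton]
  refine integral_congr_ae (Filter.Eventually.of_forall fun x => ?_)
  have hx : (x : EuclideanSpace ℝ (Fin n)) ≠ 0 := x.2
  have hx' : 0 < ‖(x : EuclideanSpace ℝ (Fin n))‖ := norm_pos_iff.2 hx
  simp only [homeomorphUnitSphereProd_apply_snd_coe, homeomorphUnitSphereProd_apply_fst_coe]
  rw [hh _ (by positivity), Real.inv_rpow hx'.le]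
  have : ‖(x : EuclideanSpace ℝ (Fin n))‖ ^ p ≠ 0 := by positivity
  field_simp

lemma sphere_univ_ne (n : ℕ) (hn : 0 < n) :
    (volume : Measure (EuclideanSpace ℝ (Fin n))).toSphere Set.univ ≠ 0 := by
  have : NeZero n := ⟨hn.ne'⟩
  rw [Ne, Measure.measure_univ_eq_zero]
  exact Measure.toSphere_ne_zero _

lemma sphere_prob (n : ℕ) (hn : 0 < n) : IsProbabilityMeasure (sphereUniform n) := by
  constructor
  unfold sphereUniform
  rw [Measure.smul_apply, smul_eq_mul, ENNReal.inv_mul_cancel (sphere_univ_ne n hn) (measure_ne_top _ _)]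

lemma sg_polar (n : ℕ) (hn : 0 < n) (p : ℝ) (h : EuclideanSpace ℝ (Fin n) → ℝ)
    (hh : ∀ (r : ℝ), 0 < r → ∀ x, h (r • x) = r ^ p * h x) :
    ∫ x, h x ∂(stdGaussian n) =
      (∫ θ, h θ ∂(sphereUniform n)) * ∫ x, ‖x‖ ^ p ∂(stdGaussian n) := by
  rw [sg_polar_aux n hn p h hh, sg_polar_aux n hn p (fun x => ‖x‖ ^ p)]
  · unfold sphereUniform
    rw [integral_smul_measure]
    have : ∫ θ : Metric.sphere (0 : EuclideanSpace ℝ (Fin n)) 1, ‖(θ : EuclideanSpace ℝ (Fin n))‖ ^ p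
        ∂((volume : Measure (EuclideanSpace ℝ (Fin n))).toSphere) =
        ((volume : Measure (EuclideanSpace ℝ (Fin n))).toSphere Set.univ).toReal := by
      simp [measureReal_def]
    rw [this, ENNReal.toReal_inv, smul_eq_mul]
    have h0 : ((volume : Measure (EuclideanSpace ℝ (Fin n))).toSphere Set.univ).toReal ≠ 0 :=
      ENNReal.toReal_ne_zero.2 ⟨sphere_univ_ne n hn, measure_ne_top _ _⟩
    generalize ((volume : Measure (EuclideanSpace ℝ (Fin n))).toSphere Set.univ).toReal = S at h0
    rw [mul_comm S⁻¹, mul_assoc, inv_mul_cancel_left₀ h0]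
  · intro r hr x
    simp only [norm_smul, Real.norm_of_nonneg hr.le]
    rw [Real.mul_rpow hr.le (norm_nonneg _)]

lemma sg_radial (n : ℕ) (hn : 0 < n) (p : ℝ) (hp : 0 ≤ p) :
    Integrable (fun x => ‖x‖ ^ p) (stdGaussian n) ∧
    ∫ x, ‖x‖ ^ p ∂(stdGaussian n) =
      n * (volume : Measure (EuclideanSpace ℝ (Fin n))).real (Metric.ball 0 1) *
       ((2 * Real.pi) ^ (-(n : ℝ) / 2) * ((1/2:ℝ) ^ (-((n:ℝ) + p) / 2) * (1/2) * Real.Gamma (((n:ℝ) + p) / 2))) := by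
  have : NeZero n := ⟨hn.ne'⟩
  have hn1 : (1:ℝ) ≤ n := by exact_mod_cast hn
  have hfun : ∀ y ∈ Set.Ioi (0:ℝ), y ^ (n - 1) * (((2 * Real.pi) ^ (-(n : ℝ) / 2) * Real.exp (-y ^ 2 / 2)) * y ^ p)
      = (2 * Real.pi) ^ (-(n : ℝ) / 2) * (y ^ ((n:ℝ) - 1 + p) * Real.exp (-(1/2) * y ^ (2:ℝ))) := by
    intro y hy
    have hy : 0 < y := hy
    rw [Real.rpow_add hy, ← Nat.cast_pred hn, Real.rpow_natCast, Real.rpow_two]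
    rw [show -y ^ 2 / 2 = -(1/2) * y ^ 2 by ring]
    ring
  constructor
  · apply sg_integrable
    rw [integrable_fun_norm_addHaar (volume : Measure (EuclideanSpace ℝ (Fin n)))
      (f := fun y => ((2 * Real.pi) ^ (-(n : ℝ) / 2) * Real.exp (-y ^ 2 / 2)) * y ^ p), finrank_euclideanSpace_fin]
    simp only [smul_eq_mul]
    rw [integrableOn_congr_fun hfun measurableSet_Ioi]
    exact (integrableOn_rpow_mul_exp_neg_mul_rpow (by linarith) (by norm_num) (by norm_num)).const_mul _
  · rw [sg_integral, integral_fun_norm_addHaar (volume : Measure (EuclideanSpace ℝ (Fin n)))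
      (f := fun y => ((2 * Real.pi) ^ (-(n : ℝ) / 2) * Real.exp (-y ^ 2 / 2)) * y ^ p), finrank_euclideanSpace_fin]
    simp only [smul_eq_mul]
    rw [setIntegral_congr_fun measurableSet_Ioi hfun, integral_const_mul,
      integral_rpow_mul_exp_neg_mul_rpow (by norm_num) (by linarith) (by norm_num)]
    rw [show (n:ℝ) - 1 + p + 1 = n + p by ring, nsmul_eq_mul]
    ring

lemma sg_two (n : ℕ) (hn : 0 < n) : ∫ x, ‖x‖ ^ (2:ℝ) ∂(stdGaussian n) = n := by
  have := sg_prob n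
  have hn1 : (0:ℝ) < n := by exact_mod_cast hn
  have h0 := (sg_radial n hn 0 le_rfl).2
  have h2 := (sg_radial n hn 2 (by norm_num)).2
  rw [show -((n:ℝ) + 2) / 2 = -((n:ℝ) + 0) / 2 - 1 by ring, Real.rpow_sub_one (by norm_num),
    show ((n:ℝ) + 2) / 2 = ((n:ℝ) + 0) / 2 + 1 by ring, Real.Gamma_add_one (by positivity)] at h2
  simp only [Real.rpow_zero, integral_const, probReal_univ, smul_eq_mul, mul_one] at h0
  rw [h2]
  linear_combination (-(n:ℝ)) * h0

/-- `E|g|^p ≥ n^{p/2}` for `p ≥ 2`. -/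
lemma sg_lower (n : ℕ) (hn : 0 < n) (p : ℝ) (hp : 2 ≤ p) :
    Real.sqrt n ^ p ≤ ∫ x, ‖x‖ ^ p ∂(stdGaussian n) := by
  have := sg_prob n
  have hn1 : (0:ℝ) < n := by exact_mod_cast hn
  have hi := (sg_radial n hn p (by linarith)).1
  have hi2 := (sg_radial n hn 2 (by norm_num)).1
  have hpt : ∀ x : EuclideanSpace ℝ (Fin n),
      Real.sqrt n ^ p * (1 + p / 2 * (‖x‖ ^ (2:ℝ) / n - 1)) ≤ ‖x‖ ^ p := by
    intro x
    have hb := one_add_mul_self_le_rpow_one_add (s := ‖x‖ ^ (2:ℝ) / n - 1) (p := p / 2)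
      (by have : 0 ≤ ‖x‖ ^ (2:ℝ) / n := by positivity
          linarith) (by linarith)
    refine (mul_le_mul_of_nonneg_left hb (by positivity)).trans (le_of_eq ?_)
    rw [add_sub_cancel, Real.div_rpow (by positivity) hn1.le, ← Real.rpow_mul (norm_nonneg _),
      Real.sqrt_eq_rpow, ← Real.rpow_mul hn1.le, show 2 * (p / 2) = p by ring,
      show 1 / 2 * p = p / 2 by ring]
    field_simp
  have hj : Integrable (fun x => ‖x‖ ^ (2:ℝ) / n - 1) (stdGaussian n) :=
    (hi2.div_const _).sub (integrable_const _)
  have hk : Integrable (fun x => 1 + p / 2 * (‖x‖ ^ (2:ℝ) / n - 1)) (stdGaussian n) :=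
    (integrable_const _).add (hj.const_mul _)
  have := integral_mono (hk.const_mul _) hi hpt
  rw [integral_const_mul, integral_add (integrable_const _) (hj.const_mul _), integral_const_mul,
    integral_sub (hi2.div_const _) (integrable_const _), integral_div, sg_two n hn, div_self hn1.ne'] at this
  simpa using this

/-- `E|g| ≤ √n`. -/
lemma sg_upper (n : ℕ) (hn : 0 < n) :
    ∫ x, ‖x‖ ^ (1:ℝ) ∂(stdGaussian n) ≤ Real.sqrt n := by
  have := sg_prob n
  have hn1 : (0:ℝ) < n := by exact_mod_cast hn
  have hs : 0 < Real.sqrt n := Real.sqrt_pos.2 hn1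
  have hi := (sg_radial n hn 1 (by linarith)).1
  have hi2 := (sg_radial n hn 2 (by norm_num)).1
  have := integral_mono (hi.const_mul (2 * Real.sqrt n)) (hi2.add (integrable_const (n:ℝ))) (fun x => by
    simp only [Real.rpow_one, Real.rpow_two, Pi.add_apply]
    have := Real.sq_sqrt hn1.le
    nlinarith [sq_nonneg (‖x‖ - Real.sqrt n)])
  rw [integral_const_mul, integral_add' hi2 (integrable_const _), sg_two n hn] at this
  simp only [integral_const, probReal_univ, smul_eq_mul, one_mul] at this
  have h2 := Real.sq_sqrt hn1.le
  nlinarith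

/-- Reverse Hölder inequality for the spherical moments `M_q(A)` of the gauge of a
symmetric convex body whose norm satisfies Gaussian concentration. -/
theorem spherical_moments_reverse_holder (c : ℝ) (hc : 0 < c) :
    ∃ c₁ : ℝ, 0 < c₁ ∧
      ∀ (n : ℕ), 0 < n →
      ∀ (A : Set (EuclideanSpace ℝ (Fin n))),
        Convex ℝ A → IsCompact A → A = -A → 0 ∈ interior A →
        ∀ b M : ℝ,
          b = ⨆ θ : Metric.sphere (0 : EuclideanSpace ℝ (Fin n)) 1, gauge A θ →
          M = ∫ θ, gauge A θ ∂(sphereUniform n) →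
        ∀ m : ℝ,
          (∀ t : ℝ, 0 < t →
            stdGaussian n {x | t < |gauge A x - m|} ≤
              ENNReal.ofReal (Real.exp (-c * t ^ 2 / b ^ 2))) →
        ∀ q : ℝ, 1 ≤ q →
          (∫ θ, gauge A θ ^ q ∂(sphereUniform n)) ^ (1 / q) ≤
            M * Real.sqrt (1 + c₁ * q * b ^ 2 / (n * M ^ 2)) := by
  refine ⟨240 / c, by positivity, ?_⟩
  intro n hn A hconv hcomp _ h0 b M hb hM m htail q hq
  have : NeZero n := ⟨hn.ne'⟩
  have := sg_prob n
  have := sphere_prob n hn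
  have hn1 : (0:ℝ) < n := by exact_mod_cast hn
  have hA0 : A ∈ nhds (0 : EuclideanSpace ℝ (Fin n)) := mem_interior_iff_mem_nhds.1 h0
  have hcont : Continuous (gauge A) := continuous_gauge hconv hA0
  have hpos : ∀ θ : Metric.sphere (0 : EuclideanSpace ℝ (Fin n)) 1, 0 < gauge A θ := by
    intro θ
    refine (gauge_pos (absorbent_nhds_zero hA0)
      (NormedSpace.isVonNBounded_of_isBounded ℝ hcomp.isBounded)).2 ?_
    exact ne_zero_of_mem_unit_sphere θ
  have hcs : Continuous (fun θ : Metric.sphere (0 : EuclideanSpace ℝ (Fin n)) 1 => gauge A θ) :=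
    hcont.comp continuous_subtype_val
  have hint : ∀ g : Metric.sphere (0 : EuclideanSpace ℝ (Fin n)) 1 → ℝ, Continuous g →
      Integrable g (sphereUniform n) := fun g hg =>
    hg.integrable_of_hasCompactSupport (HasCompactSupport.of_compactSpace g)
  have hcq : ∀ r : ℝ, Continuous
      (fun θ : Metric.sphere (0 : EuclideanSpace ℝ (Fin n)) 1 => gauge A θ ^ r) := fun r =>
    hcs.rpow_const fun θ => Or.inl (hpos θ).ne'
  have hbpos : 0 < b := by
    obtain ⟨θ₀⟩ : Nonempty (Metric.sphere (0 : EuclideanSpace ℝ (Fin n)) 1) :=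
      (NormedSpace.sphere_nonempty.2 zero_le_one).to_subtype
    rw [hb]
    exact (hpos θ₀).trans_le (le_ciSup (isCompact_range hcs).bddAbove θ₀)
  have hMpos : 0 < M := by
    rw [hM, integral_pos_iff_support_of_nonneg (fun θ => (hpos θ).le) (hint _ hcs)]
    have : Function.support (fun θ : Metric.sphere (0 : EuclideanSpace ℝ (Fin n)) 1 => gauge A θ)
        = Set.univ := by
      ext θ; simp [(hpos θ).ne']
    rw [this, measure_univ]; exact one_pos
  set p := q + 1 with hp
  set s := c / (4 * b ^ 2) with hs
  have hspos : 0 < s := by positivity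
  have hmom := aux_moment (stdGaussian n) (gauge A) hcont.measurable (fun x => gauge_nonneg x) m s hspos
    (by
      intro t ht
      convert htail t ht using 3
      rw [hs]; field_simp) p (by linarith)
  have hpol1 := sg_polar n hn 1 (gauge A) (by
    intro r hr x
    rw [gauge_smul_of_nonneg hr.le, Real.rpow_one, smul_eq_mul])
  have hpolp := sg_polar n hn p (fun x => gauge A x ^ p) (by
    intro r hr x
    simp only [gauge_smul_of_nonneg hr.le, smul_eq_mul]
    rw [Real.mul_rpow hr.le (gauge_nonneg _)])
  rw [hpolp, hpol1, ← hM] at hmom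
  set Mp := ∫ θ, gauge A θ ^ p ∂(sphereUniform n) with hMp
  have hMp0 : 0 ≤ Mp := integral_nonneg fun θ => Real.rpow_nonneg (gauge_nonneg _) _
  have hlow := sg_lower n hn p (by linarith)
  have hup := sg_upper n hn
  have hE0 : 0 ≤ ∫ x, ‖x‖ ^ (1:ℝ) ∂(stdGaussian n) :=
    integral_nonneg fun x => Real.rpow_nonneg (norm_nonneg _) _
  set R := M ^ 2 + 240 * q * b ^ 2 / (c * n) with hR
  have hR0 : 0 ≤ R := by positivity
  have hsn : 0 < Real.sqrt n := Real.sqrt_pos.2 hn1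
  have hkey : Mp ≤ Real.sqrt R ^ p := by
    have h1 : Mp * Real.sqrt n ^ p ≤ (Real.sqrt R * Real.sqrt n) ^ p := by
      refine (mul_le_mul_of_nonneg_left hlow hMp0).trans (hmom.trans ?_)
      apply Real.rpow_le_rpow (Real.sqrt_nonneg _) _ (by linarith)
      rw [← Real.sqrt_mul hR0]
      apply Real.sqrt_le_sqrt
      have h2 : (M * ∫ x, ‖x‖ ^ (1:ℝ) ∂(stdGaussian n)) ^ 2 ≤ M ^ 2 * n := by
        rw [mul_pow]
        gcongr
        calc _ ≤ Real.sqrt n ^ 2 := by gcongr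
          _ = n := Real.sq_sqrt hn1.le
      have h3 : 30 * p / s = 120 * p * b ^ 2 / c := by rw [hs]; field_simp; ring
      have h4 : R * n = M ^ 2 * n + 120 * (2 * q) * b ^ 2 / c := by rw [hR]; field_simp; ring
      rw [h3, h4]
      gcongr
      linarith
    rw [Real.mul_rpow (Real.sqrt_nonneg _) hsn.le] at h1
    exact le_of_mul_le_mul_right h1 (by positivity)
  have hjen : (∫ θ, gauge A θ ^ q ∂(sphereUniform n)) ^ (p / q) ≤ Mp := by
    have hpq : 1 ≤ p / q := by rw [le_div_iff₀ (by linarith)]; linarith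
    have hfe : ∀ θ : Metric.sphere (0 : EuclideanSpace ℝ (Fin n)) 1,
        (gauge A θ ^ q) ^ (p / q) = gauge A θ ^ p := fun θ => by
      rw [← Real.rpow_mul (gauge_nonneg _), mul_div_cancel₀ _ (by linarith : q ≠ 0)]
    have := (convexOn_rpow hpq).map_integral_le (μ := sphereUniform n)
      (f := fun θ => gauge A θ ^ q)
      (Real.continuous_rpow_const (by linarith)).continuousOn isClosed_Ici
      (Filter.Eventually.of_forall fun θ => Real.rpow_nonneg (gauge_nonneg _) _)
      (hint _ (hcq q))
      (by
        have : ((fun x : ℝ => x ^ (p / q)) ∘ fun θ : Metric.sphere (0 : EuclideanSpace ℝ (Fin n)) 1 =>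
          gauge A θ ^ q) =
            fun θ : Metric.sphere (0 : EuclideanSpace ℝ (Fin n)) 1 => gauge A θ ^ p := funext hfe
        rw [this]; exact hint _ (hcq p))
    simp only [hfe] at this
    exact this
  have hI0 : 0 ≤ ∫ θ, gauge A θ ^ q ∂(sphereUniform n) :=
    integral_nonneg fun θ => Real.rpow_nonneg (gauge_nonneg _) _
  have hfin : (∫ θ, gauge A θ ^ q ∂(sphereUniform n)) ^ (1 / q) ≤ Real.sqrt R := by
    have hp0 : 0 < p := by linarith
    have := Real.rpow_le_rpow (Real.rpow_nonneg hI0 _) (hjen.trans hkey) (one_div_nonneg.2 hp0.le)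
    rw [← Real.rpow_mul hI0, ← Real.rpow_mul (Real.sqrt_nonneg _), mul_one_div_cancel hp0.ne',
      Real.rpow_one] at this
    rwa [show p / q * (1 / p) = 1 / q by field_simp] at this
  refine hfin.trans (le_of_eq ?_)
  have hRe : R = M ^ 2 * (1 + 240 / c * q * b ^ 2 / (n * M ^ 2)) := by
    rw [hR]; field_simp
  rw [hRe, Real.sqrt_mul (by positivity), Real.sqrt_sq hMpos.le]
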